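/- arXiv:2211.03354 — 3 statements merged into one kernel-verified Lean document; each statement's English description precedes it below -/
import Mathlib

section
/- Let λ ≠ μ be weights of type (m,n) with |λ| ≤ |μ|. Then there is at most one weight ν adjacent in Γ_m^n to both λ and μ with |ν| > |μ|; equivalently, at most one path of length 2 between λ and μ passes through a vertex of height strictly greater than |μ|. -/
open scoped Classical

namespace Kh

abbrev Wt (N : ℕ) := Fin N → Bool

variable {N : ℕ}

/-- A weight of type `(m,n)`: `m` downs (`true`) and `n` ups (`false`). -/
def IsWeight (m n : ℕ) (l : Wt N) : Prop :=
  {i : Fin N | l i = true}.ncard = m ∧ {i : Fin N | l i = false}.ncard = n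

/-- The height of a weight: sum over downs of the number of ups to the left. -/
noncomputable def height (l : Wt N) : ℕ :=
  ∑ i : Fin N, if l i = true then {j : Fin N | j < i ∧ l j = false}.ncard else 0

/-- Number of positions `t` with `i < t ≤ j` and value `b`. -/
noncomputable def cnt (l : Wt N) (b : Bool) (i j : Fin N) : ℕ :=
  {t : Fin N | i < t ∧ t ≤ j ∧ l t = b}.ncard

/-- `(i,j)` is a matched pair ("circle") of the standard non-crossing bracket matching
of `l` (reading `true` = ↓ as an opening bracket and `false` = ↑ as a closing bracket):
`l i = ↓`, `l j = ↑`, the segment strictly between `i` and `j` is balanced and every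
prefix of it has at least as many ↓'s as ↑'s. -/
def IsCircle (l : Wt N) (i j : Fin N) : Prop :=
  i < j ∧ l i = true ∧ l j = false ∧
    cnt l true i j + 1 = cnt l false i j ∧
    ∀ k : Fin N, i < k → k < j → cnt l false i k ≤ cnt l true i k

/-- `s_C(λ)`: exchange the values of `l` at the two positions of the circle `C = (i,j)`. -/
def swapC (l : Wt N) (i j : Fin N) : Wt N :=
  fun t => if t = i then l j else if t = j then l i else l t

/-- The circle `(i,j)` encloses the circle `(i',j')`. -/
def Encloses (i j i' j' : Fin N) : Prop := i < i' ∧ j' < j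

/-- The circle `(i,j)` lies to the left of the circle `(i',j')`. -/
def LeftOf (i j i' j' : Fin N) : Prop := j < i'

/-- The position `p` is unmatched in `l`. -/
def Unmatched (l : Wt N) (p : Fin N) : Prop :=
  ∀ q : Fin N, ¬ IsCircle l p q ∧ ¬ IsCircle l q p

/-- `def(λ)`: the number of circles of `l`. -/
noncomputable def defect (l : Wt N) : ℕ :=
  {p : Fin N × Fin N | IsCircle l p.1 p.2}.ncard

/-- One step up in the graph `Γ_m^n`: `m' = s_C(l)` for some circle `C` of `l`. -/
def GammaStep (l m' : Wt N) : Prop :=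
  ∃ i j : Fin N, IsCircle l i j ∧ m' = swapC l i j

/-- Adjacency in the graph `Γ_m^n`. -/
def GammaAdj (l m' : Wt N) : Prop := GammaStep l m' ∨ GammaStep m' l

/-- The order embedding `Fin N → Fin (N+2)` skipping the two positions `i`, `i+1`;
composing a weight with it deletes these two positions. -/
def skip2 (i : ℕ) {N : ℕ} (t : Fin N) : Fin (N + 2) :=
  if (t : ℕ) < i then Fin.castLE (Nat.le_add_right N 2) t
  else ⟨(t : ℕ) + 2, Nat.add_lt_add_right t.isLt 2⟩

end Kh

namespace Kh

lemma cnt_add {N : ℕ} (l : Wt N) (b : Bool) {i k j : Fin N} (h1 : i ≤ k) (h2 : k ≤ j) :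
    cnt l b i k + cnt l b k j = cnt l b i j := by
  unfold cnt
  rw [← Set.ncard_union_eq]
  · congr 1
    ext t
    simp only [Set.mem_union, Set.mem_setOf_eq]
    constructor
    · rintro (⟨a, c, d⟩ | ⟨a, c, d⟩)
      · exact ⟨a, c.trans h2, d⟩
      · exact ⟨h1.trans_lt a, c, d⟩
    · rintro ⟨a, c, d⟩
      rcases le_or_gt t k with h | h
      · exact Or.inl ⟨a, h, d⟩
      · exact Or.inr ⟨h, c, d⟩
  · rw [Set.disjoint_left]
    rintro t ⟨_, a, _⟩ ⟨c, _, _⟩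
    exact absurd a (not_le.mpr c)

lemma circle_inner {N : ℕ} {l : Wt N} {i j k : Fin N} (h : IsCircle l i j) (h1 : i < k)
    (h2 : k < j) (hk : l k = true) : cnt l false i k < cnt l true i k := by
  obtain ⟨p, hp⟩ : ∃ p : Fin N, (p : ℕ) + 1 = k :=
    ⟨⟨(k : ℕ) - 1, by omega⟩, by simp only; have : (i : ℕ) < k := h1; omega⟩
  have hip : i ≤ p := by rw [Fin.le_def]; have : (i : ℕ) < k := h1; omega
  have hpk : p < k := by rw [Fin.lt_def]; omega
  have hmem : ∀ t : Fin N, p < t ∧ t ≤ k ↔ t = k := by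
    intro t
    rw [Fin.lt_def, Fin.le_def, Fin.ext_iff]; omega
  have e1 : cnt l true p k = 1 := by
    unfold cnt
    rw [Set.ncard_eq_one]
    refine ⟨k, ?_⟩
    ext t
    simp only [← and_assoc, hmem, Set.mem_setOf_eq, Set.mem_singleton_iff]
    constructor
    · exact fun h => h.1
    · rintro rfl; exact ⟨rfl, hk⟩
  have e2 : cnt l false p k = 0 := by
    unfold cnt
    rw [Set.ncard_eq_zero]
    ext t
    simp only [← and_assoc, hmem, Set.mem_setOf_eq, Set.mem_empty_iff_false, iff_false]
    rintro ⟨rfl, h⟩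
    simp [hk] at h
  have a1 := cnt_add l true hip hpk.le
  have a2 := cnt_add l false hip hpk.le
  have : cnt l false i p ≤ cnt l true i p := by
    rcases hip.eq_or_lt with e | e
    · subst e
      have z : cnt l false i i = 0 := by
        unfold cnt
        rw [Set.ncard_eq_zero]
        ext t
        simp only [Set.mem_setOf_eq, Set.mem_empty_iff_false, iff_false]
        rintro ⟨h, h', _⟩
        exact absurd h' (not_le.mpr h)
      omega
    · exact h.2.2.2.2 p e (hpk.trans h2)
  omega

lemma circle_right {N : ℕ} {l : Wt N} {i j j' : Fin N} (h : IsCircle l i j)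
    (h' : IsCircle l i j') : j = j' := by
  rcases lt_trichotomy j j' with e | e | e
  · have := h'.2.2.2.2 j h.1 e
    have := h.2.2.2.1
    omega
  · exact e
  · have := h.2.2.2.2 j' h'.1 e
    have := h'.2.2.2.1
    omega

lemma circle_left_aux {N : ℕ} {l : Wt N} {i i' j : Fin N} (h : IsCircle l i j)
    (h' : IsCircle l i' j) : ¬ i < i' := by
  intro e
  have := circle_inner h e h'.1 h'.2.1
  have := cnt_add l true e.le h'.1.le
  have := cnt_add l false e.le h'.1.le
  have := h.2.2.2.1
  have := h'.2.2.2.1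
  omega

lemma circle_left {N : ℕ} {l : Wt N} {i i' j : Fin N} (h : IsCircle l i j)
    (h' : IsCircle l i' j) : i = i' :=
  le_antisymm (not_lt.mp (circle_left_aux h' h)) (not_lt.mp (circle_left_aux h h'))

lemma circle_cross {N : ℕ} {l : Wt N} {i j i' j' : Fin N} (h : IsCircle l i j)
    (h' : IsCircle l i' j') (h1 : i < i') (h2 : i' < j) (h3 : j < j') : False := by
  have := h.2.2.2.2 i' h1 h2
  have := h'.2.2.2.2 j h2 h3
  have := cnt_add l true h1.le h2.le
  have := cnt_add l false h1.le h2.le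
  have := h.2.2.2.1
  omega

/-- The inversions of a weight, counted by the height. -/
noncomputable def invs {N : ℕ} (l : Wt N) : Finset (Fin N × Fin N) :=
  Finset.univ.filter fun p => p.2 < p.1 ∧ l p.1 = true ∧ l p.2 = false

lemma height_eq {N : ℕ} (l : Wt N) : height l = (invs l).card := by
  unfold height invs
  rw [Finset.card_filter, Fintype.sum_prod_type]
  refine Finset.sum_congr rfl fun i _ => ?_
  split_ifs with h
  · rw [← Finset.card_filter, ← Set.ncard_coe_finset]
    congr 1
    ext t
    simp [h]
  · simp [h]

lemma height_le {N : ℕ} {l l' : Wt N} (h : GammaStep l l') : height l ≤ height l' := by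
  obtain ⟨i, j, hc, rfl⟩ := h
  obtain ⟨hij, hi, hj, -⟩ := hc
  rw [height_eq, height_eq]
  refine Finset.card_le_card_of_injOn
    (fun p => (Equiv.swap i j p.1, Equiv.swap i j p.2)) ?_ ?_
  · rintro ⟨a, b⟩ hp
    simp only [invs, Finset.coe_filter, Finset.mem_univ, true_and, Set.mem_setOf_eq] at hp ⊢
    obtain ⟨h1, h2, h3⟩ := hp
    have haj : a ≠ j := by rintro rfl; simp [hj] at h2
    have hbi : b ≠ i := by rintro rfl; simp [hi] at h3
    have hne : i ≠ j := hij.ne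
    simp only [swapC, Equiv.swap_apply_def]
    by_cases ha : a = i <;> by_cases hb : b = j <;> simp_all
    · exact ⟨h1.trans hij, hij.ne'⟩
    · exact hij.trans h1
  · rintro ⟨a, b⟩ _ ⟨c, d⟩ _ h
    simpa using h

/-- Pointwise data of two steps up to a common weight. -/
lemma steps_cases {N : ℕ} {la mu nu : Wt N} (hne : la ≠ mu) {i j k l : Fin N}
    (hC : IsCircle la i j) (hD : IsCircle mu k l)
    (h1 : nu = swapC la i j) (h2 : nu = swapC mu k l) :
    (i = k ∧ j ≠ l ∧ ∀ t, (la t = true ∧ mu t = false ↔ t = l) ∧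
        (la t = false ∧ mu t = true ↔ t = j)) ∨
    (i ≠ k ∧ j = l ∧ ∀ t, (la t = true ∧ mu t = false ↔ t = i) ∧
        (la t = false ∧ mu t = true ↔ t = k)) ∨
    (i ≠ k ∧ j ≠ l ∧ i ≠ l ∧ j ≠ k ∧ ∀ t, (la t = true ∧ mu t = false ↔ t = i ∨ t = l) ∧
        (la t = false ∧ mu t = true ↔ t = j ∨ t = k)) := by
  obtain ⟨hij, hi, hj, -⟩ := hC
  obtain ⟨hkl, hk, hl, -⟩ := hD
  have hij' := hij.ne
  have hkl' := hkl.ne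
  have e : ∀ t, (if t = i then false else if t = j then true else la t) =
      (if t = k then false else if t = l then true else mu t) := by
    intro t
    have := congrFun (h1.symm.trans h2) t
    simpa only [swapC, hi, hj, hk, hl] using this
  have hil : i ≠ l := by
    rintro rfl
    have := e i
    simp [hkl'.symm] at this
  have hjk : j ≠ k := by
    rintro rfl
    have := e j
    simp [hij'.symm] at this
  by_cases hik : i = k
  · by_cases hjl : j = l
    · exfalso
      apply hne
      subst hik hjl
      funext t
      have := e t
      by_cases a : t = i
      · rw [a, hi, hk]
      · by_cases b : t = j
        · rw [b, hj, hl]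
        · simpa [a, b] using this
    · refine Or.inl ⟨hik, hjl, fun t => ?_⟩
      have := e t
      grind
  · by_cases hjl : j = l
    · refine Or.inr (Or.inl ⟨hik, hjl, fun t => ?_⟩)
      have := e t
      grind
    · refine Or.inr (Or.inr ⟨hik, hjl, hil, hjk, fun t => ?_⟩)
      have := e t
      grind

/-- The mixed case (shared left end versus shared right end) is impossible. -/
lemma no_mixed {N : ℕ} {la mu : Wt N} {i j l r : Fin N} (hjl : j ≠ l)
    (a : IsCircle la i j) (b : IsCircle mu i l) (c : IsCircle la l r)
    (d : IsCircle mu j r) : False := by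
  rcases lt_or_gt_of_ne hjl with h | h
  · exact circle_cross b d a.1 h c.1
  · exact circle_cross a c b.1 h d.1

/-- At most one length-2 path in `Γ_m^n` between distinct weights
`λ`, `μ` with `|λ| ≤ |μ|` passes through a vertex of height strictly greater than `|μ|`. -/
theorem statement4 (m n : ℕ) (hm : 1 ≤ m) (hn : 1 ≤ n) {N : ℕ} (hN : N = m + n)
    (la mu : Wt N) (hla : IsWeight m n la) (hmu : IsWeight m n mu)
    (hne : la ≠ mu) (hle : height la ≤ height mu) :
    ∀ nu nu' : Wt N,
      IsWeight m n nu → GammaAdj la nu → GammaAdj nu mu → height mu < height nu →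
      IsWeight m n nu' → GammaAdj la nu' → GammaAdj nu' mu → height mu < height nu' →
      nu = nu' := by
  intro nu nu' _ hA hB hlt _ hA' hB' hlt'
  have up : ∀ x : Wt N, GammaAdj la x → GammaAdj x mu → height mu < height x →
      GammaStep la x ∧ GammaStep mu x := by
    intro x a b c
    constructor
    · rcases a with a | a
      · exact a
      · have := height_le a
        omega
    · rcases b with b | b
      · have := height_le b
        omega
      · exact b
  obtain ⟨⟨i, j, hC, e1⟩, ⟨k, l, hD, e2⟩⟩ := up nu hA hB hlt
  obtain ⟨⟨i', j', hC', e1'⟩, ⟨k', l', hD', e2'⟩⟩ := up nu' hA' hB' hlt'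
  have key : i = i' ∨ j = j' → nu = nu' := by
    rintro (h | h)
    · subst h
      have := circle_right hC hC'
      subst this
      rw [e1, e1']
    · subst h
      have := circle_left hC hC'
      subst this
      rw [e1, e1']
  rcases steps_cases hne hC hD e1 e2 with ⟨p, q, h⟩ | ⟨p, q, h⟩ | ⟨p, q, r, s, h⟩ <;>
    rcases steps_cases hne hC' hD' e1' e2' with ⟨p', q', h'⟩ | ⟨p', q', h'⟩ | ⟨p', q', r', s', h'⟩
  · exact key (Or.inr ((h' j).2.mp ((h j).2.mpr rfl)))
  · have x1 : l = i' := (h' l).1.mp ((h l).1.mpr rfl)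
    have x2 : j = k' := (h' j).2.mp ((h j).2.mpr rfl)
    subst p q' x1 x2
    exact (no_mixed q hC hD hC' hD').elim
  · have x1 := (h i').1.mp ((h' i').1.mpr (Or.inl rfl))
    have x2 := (h l').1.mp ((h' l').1.mpr (Or.inr rfl))
    exact absurd (x1.trans x2.symm) r'
  · have x1 : l' = i := (h l').1.mp ((h' l').1.mpr rfl)
    have x2 : j' = k := (h j').2.mp ((h' j').2.mpr rfl)
    subst p' q x1 x2
    exact (no_mixed q' hC' hD' hC hD).elim
  · exact key (Or.inl ((h' i).1.mp ((h i).1.mpr rfl)))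
  · have x1 := (h i').1.mp ((h' i').1.mpr (Or.inl rfl))
    have x2 := (h l').1.mp ((h' l').1.mpr (Or.inr rfl))
    exact absurd (x1.trans x2.symm) r'
  · have x1 := (h' i).1.mp ((h i).1.mpr (Or.inl rfl))
    have x2 := (h' l).1.mp ((h l).1.mpr (Or.inr rfl))
    exact absurd (x1.trans x2.symm) r
  · have x1 := (h' i).1.mp ((h i).1.mpr (Or.inl rfl))
    have x2 := (h' l).1.mp ((h l).1.mpr (Or.inr rfl))
    exact absurd (x1.trans x2.symm) r
  · rcases (h i').1.mp ((h' i').1.mpr (Or.inl rfl)) with x | x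
    · exact key (Or.inl x.symm)
    · rcases (h j').2.mp ((h' j').2.mpr (Or.inl rfl)) with y | y
      · exact key (Or.inr y.symm)
      · subst x y
        exact absurd hC'.1 (not_lt.mpr hD.1.le)

end Kh
end

section
/- For every weight λ of type (m,n), the map C ↦ s_C(λ) is a bijection from the set of circles of λ onto the set of weights μ adjacent to λ in Γ_m^n with |μ| > |λ|. In particular, λ has exactly def(λ) neighbours in Γ_m^n of height greater than |λ|. -/
open scoped Classical

namespace Kh

theorem height_eq_s8 {N : ℕ} (l : Wt N) : height l =
    (Finset.univ.filter (fun p : Fin N × Fin N =>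
      p.1 < p.2 ∧ l p.1 = false ∧ l p.2 = true)).card := by
  unfold height
  rw [Finset.card_filter, Fintype.sum_prod_type_right]
  refine Finset.sum_congr rfl fun i _ => ?_
  split_ifs with h
  · rw [Set.ncard_eq_toFinset_card', ← Finset.card_filter]
    congr 1
    ext x
    simp [h]
  · simp [h]

theorem swapC_eq {N : ℕ} (l : Wt N) (i j : Fin N) :
    swapC l i j = fun t => l (Equiv.swap i j t) := by
  funext t
  unfold swapC
  rw [Equiv.swap_apply_def]
  split_ifs <;> rfl

theorem swapC_weight {N m n : ℕ} (l : Wt N) (i j : Fin N) (h : IsWeight m n l) :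
    IsWeight m n (swapC l i j) := by
  rw [swapC_eq]
  have key : ∀ b : Bool, {t : Fin N | l (Equiv.swap i j t) = b}.ncard
      = {t : Fin N | l t = b}.ncard := by
    intro b
    refine Set.ncard_congr (fun t _ => Equiv.swap i j t) (fun t ht => ht)
      (fun a b _ _ hab => (Equiv.swap i j).injective hab) ?_
    intro t ht
    exact ⟨Equiv.swap i j t, by simpa using ht, by simp⟩
  exact ⟨(key true).trans h.1, (key false).trans h.2⟩

theorem height_swap {N : ℕ} (l : Wt N) (i j : Fin N) (hij : i < j)
    (hi : l i = true) (hj : l j = false) : height l < height (swapC l i j) := by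
  rw [height_eq_s8, height_eq_s8, ← Finset.card_map
    ((Equiv.prodCongr (Equiv.swap i j) (Equiv.swap i j)).toEmbedding)]
  apply Finset.card_lt_card
  rw [Finset.ssubset_iff_of_subset]
  · refine ⟨(i, j), ?_, ?_⟩
    · simp [swapC, hij, hi, hj, hij.ne']
    · rw [Finset.mem_map]
      rintro ⟨⟨a, b⟩, hab, he⟩
      simp only [Finset.mem_filter, Finset.mem_univ, true_and] at hab
      simp only [Equiv.coe_toEmbedding, Equiv.prodCongr_apply, Prod.map_apply, Prod.mk.injEq] at he
      rw [Equiv.swap_apply_eq_iff, Equiv.swap_apply_eq_iff] at he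
      simp only [Equiv.swap_apply_left, Equiv.swap_apply_right] at he
      obtain ⟨rfl, rfl⟩ := he
      exact absurd hij (not_lt.mpr hab.1.le)
  · intro p hp
    rw [Finset.mem_map] at hp
    obtain ⟨⟨a, b⟩, hab, rfl⟩ := hp
    simp only [Finset.mem_filter, Finset.mem_univ, true_and] at hab
    obtain ⟨h1, h2, h3⟩ := hab
    rw [swapC_eq]
    simp only [Finset.mem_filter, Finset.mem_univ, true_and, Equiv.coe_toEmbedding,
      Equiv.prodCongr_apply, Prod.map_apply, Equiv.swap_apply_self, h2, h3, and_true]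
    have ha : a ≠ i := by rintro rfl; simp [hi] at h2
    have hb : b ≠ j := by rintro rfl; simp [hj] at h3
    rw [Equiv.swap_apply_def, Equiv.swap_apply_def]
    split_ifs with c1 c2 c3 <;> (try subst a) <;> (try subst b) <;> order

/-- For every weight `λ`, the map `C ↦ s_C(λ)` is a bijection from
the set of circles of `λ` onto the set of weights adjacent to `λ` in `Γ_m^n` of
height greater than `|λ|`; in particular `λ` has exactly `def(λ)` such neighbours. -/
theorem statement8 (m n : ℕ) (hm : 1 ≤ m) (hn : 1 ≤ n) {N : ℕ} (hN : N = m + n)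
    (la : Wt N) (hla : IsWeight m n la) :
    Set.BijOn (fun p : Fin N × Fin N => swapC la p.1 p.2)
      {p : Fin N × Fin N | IsCircle la p.1 p.2}
      {mu : Wt N | IsWeight m n mu ∧ GammaAdj la mu ∧ height la < height mu} ∧
    {mu : Wt N | IsWeight m n mu ∧ GammaAdj la mu ∧ height la < height mu}.ncard =
      defect la := by
  have hbij : Set.BijOn (fun p : Fin N × Fin N => swapC la p.1 p.2)
      {p : Fin N × Fin N | IsCircle la p.1 p.2}
      {mu : Wt N | IsWeight m n mu ∧ GammaAdj la mu ∧ height la < height mu} := by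
    refine ⟨?_, ?_, ?_⟩
    · rintro ⟨i, j⟩ h
      have h' : IsCircle la i j := h
      exact ⟨swapC_weight _ _ _ hla, Or.inl ⟨i, j, h', rfl⟩,
        height_swap _ _ _ h'.1 h'.2.1 h'.2.2.1⟩
    · rintro ⟨i, j⟩ ⟨_, hi, hj, _⟩ ⟨i', j'⟩ ⟨_, hi', hj', _⟩ he
      have e1 := congrFun he i
      have e2 := congrFun he j
      simp only [swapC] at e1 e2 hi hj hi' hj'
      grind
    · rintro mu ⟨_, h | h, hh⟩
      · obtain ⟨i, j, hc, rfl⟩ := h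
        exact ⟨(i, j), hc, rfl⟩
      · obtain ⟨i, j, hc, rfl⟩ := h
        exact absurd hh (height_swap _ _ _ hc.1 hc.2.1 hc.2.2.1).le.not_gt
  refine ⟨hbij, ?_⟩
  rw [← hbij.image_eq, Set.ncard_image_of_injOn hbij.injOn]
  rfl

end Kh
end

section
/- Let p = ȳ_{λ_1}^{λ_2} ȳ_{λ_2}^{λ_3} ⋯ ȳ_{λ_k}^{λ_{k+1}} be an ascending path of length k ≥ 2 in Q̄_m^n, with λ_{i+1} = s_{C_i}(λ_i) for a circle C_i of λ_i (1 ≤ i ≤ k). For each i let h_i be the largest h with 0 ≤ h ≤ i−1 such that C_i is a circle of λ_{i−j} for all 0 ≤ j ≤ h. Then p is irreducible if and only if for every i with h_i ≠ 0 and every 0 < j ≤ h_i, the circle C_i, viewed as a circle of λ_{i−j}, either lies to the left of C_{i−j} or encloses C_{i−j}. In particular, if h_i = 0 for all 1 ≤ i ≤ k, then p is irreducible. -/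
open scoped Classical

namespace Kh

variable {N : ℕ}

/-- Type (I) elements of `S_m^n`: an ascending arrow into a vertex followed by a
descending arrow out of it (as vertex lists of the corresponding paths in `Q̄_m^n`). -/
def SType1 (p : List (Wt N)) : Prop :=
  ∃ x y z : Wt N, p = [x, y, z] ∧ GammaStep x y ∧ GammaStep z y

/-- Ascending type (II) elements of `S_m^n`: `ȳ_λ^ν ȳ_ν^μ` with `ν = s_C(λ)`,
`μ = s_{C'}(ν)`, where `C'` is a circle of `λ` enclosed in `C` or lying to the right
of `C`. -/
def SType2Asc (p : List (Wt N)) : Prop :=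
  ∃ (la : Wt N) (i j i' j' : Fin N),
    IsCircle la i j ∧ IsCircle la i' j' ∧
    (Encloses i j i' j' ∨ LeftOf i j i' j') ∧
    IsCircle (swapC la i j) i' j' ∧
    p = [la, swapC la i j, swapC (swapC la i j) i' j']

/-- Ascending type (III) elements of `S_m^n` (length `k ≥ 3`), written with 0-based
vertices `v 0, …, v k` (so `λ_t = v (t-1)`) and 1-based circles `C_i = (a i, b i)`. -/
def SType3Asc (p : List (Wt N)) : Prop :=
  ∃ (k : ℕ) (v : ℕ → Wt N) (a b : ℕ → Fin N),
    3 ≤ k ∧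
    p = List.ofFn (fun t : Fin (k + 1) => v t.val) ∧
    (∀ i, 1 ≤ i → i ≤ k →
      IsCircle (v (i - 1)) (a i) (b i) ∧ v i = swapC (v (i - 1)) (a i) (b i)) ∧
    (∀ i, 2 ≤ i → i ≤ k - 1 → ¬ IsCircle (v (i - 2)) (a i) (b i)) ∧
    (∀ j, 1 ≤ j → j ≤ k → IsCircle (v (j - 1)) (a k) (b k)) ∧
    Encloses (a 1) (b 1) (a k) (b k) ∧
    (∀ i, 2 ≤ i → i ≤ k - 1 → LeftOf (a k) (b k) (a i) (b i))

/-- Membership in the reduction set `S_m^n` (vertex-list model: the descending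
elements are the reverses of the ascending ones). -/
def InS (p : List (Wt N)) : Prop :=
  SType1 p ∨ SType2Asc p ∨ SType2Asc p.reverse ∨ SType3Asc p ∨ SType3Asc p.reverse

/-- A path in `Q̄_m^n` (given by its vertex list) is irreducible if no contiguous
subpath of it belongs to `S_m^n`. -/
def Irreducible (p : List (Wt N)) : Prop :=
  ∀ s, s <:+: p → ¬ InS s

/-- The number of ascending irreducible paths of length `k` from `la` to `mu`. -/
noncomputable def ascCount (k : ℕ) (la mu : Wt N) : ℕ :=
  {p : List (Wt N) | p.length = k + 1 ∧ p.head? = some la ∧ p.getLast? = some mu ∧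
    p.Chain' GammaStep ∧ Irreducible p}.ncard

/-- The total number of irreducible paths from `la` to `mu`. -/
noncomputable def irrCount (la mu : Wt N) : ℕ :=
  {p : List (Wt N) | p ≠ [] ∧ p.head? = some la ∧ p.getLast? = some mu ∧
    p.Chain' GammaAdj ∧ Irreducible p}.ncard

end Kh

namespace Kh

/-- Circle predicate in terms of a height function. -/
def HC (f : ℕ → ℤ) (i j : ℕ) : Prop :=
  i < j ∧ f (j + 1) = f i ∧ ∀ x, i < x → x ≤ j → f i < f x

/-- Effect of a swap on the height function. -/
def HS (f : ℕ → ℤ) (p q : ℕ) : ℕ → ℤ := fun x => if p < x ∧ x ≤ q then f x - 2 else f x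

def StepOK (f : ℕ → ℤ) : Prop := ∀ x, f (x + 1) ≤ f x + 1 ∧ f x ≤ f (x + 1) + 1

lemma HC_nested {f : ℕ → ℤ} {i j i' j' : ℕ} (h : HC f i j) (h' : HC f i' j') :
    (i = i' ∧ j = j') ∨ j < i' ∨ j' < i ∨ (i < i' ∧ j' < j) ∨ (i' < i ∧ j < j') := by
  obtain ⟨h1, h2, h3⟩ := h
  obtain ⟨g1, g2, g3⟩ := h'
  have a1 := h3 i'
  have a2 := h3 (j' + 1)
  have b1 := g3 i
  have b2 := g3 (j + 1)
  rcases lt_trichotomy i i' with hi | hi | hi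
  · by_cases hj : j < i'
    · omega
    · have hlt := a1 hi (by omega)
      have : j' ≤ j := by
        by_contra hc
        have := b2 (by omega) (by omega)
        omega
      rcases eq_or_lt_of_le this with he | he
      · subst he; omega
      · omega
  · subst hi
    rcases lt_trichotomy j j' with hj | hj | hj
    · have := b2 (by omega) (by omega); omega
    · omega
    · have := a2 (by omega) (by omega); omega
  · by_cases hj : j' < i
    · omega
    · have hlt := b1 hi (by omega)
      have : j ≤ j' := by
        by_contra hc
        have := a2 (by omega) (by omega)
        omega
      rcases eq_or_lt_of_le this with he | he
      · subst he; omega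
      · omega

lemma HC_of_shift {f g : ℕ → ℤ} {i j : ℕ} (c : ℤ) (hfg : ∀ x, i ≤ x → x ≤ j + 1 → g x = f x + c)
    (h : HC f i j) : HC g i j := by
  obtain ⟨h1, h2, h3⟩ := h
  refine ⟨h1, ?_, fun x hx hx' => ?_⟩
  · rw [hfg _ (by omega) (by omega), hfg _ (by omega) (by omega), h2]
  · rw [hfg _ (by omega) (by omega), hfg _ (by omega) (by omega)]
    have := h3 x hx hx'
    omega

lemma HC_local {f : ℕ → ℤ} {i j p q : ℕ} (hp : j < p ∨ q < i ∨ (p < i ∧ j < q)) :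
    HC (HS f p q) i j ↔ HC f i j := by
  rcases hp with hp | hp | hp
  · have key : ∀ x, i ≤ x → x ≤ j + 1 → HS f p q x = f x := by
      intro x hx hx'; unfold HS; rw [if_neg (by omega)]
    exact ⟨HC_of_shift 0 (fun x a b => by rw [key x a b]; omega),
      HC_of_shift 0 (fun x a b => by rw [key x a b]; omega)⟩
  · have key : ∀ x, i ≤ x → x ≤ j + 1 → HS f p q x = f x := by
      intro x hx hx'; unfold HS; rw [if_neg (by omega)]
    exact ⟨HC_of_shift 0 (fun x a b => by rw [key x a b]; omega),
      HC_of_shift 0 (fun x a b => by rw [key x a b]; omega)⟩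
  · have key : ∀ x, i ≤ x → x ≤ j + 1 → HS f p q x = f x - 2 := by
      intro x hx hx'; unfold HS; rw [if_pos (by omega)]
    exact ⟨HC_of_shift 2 (fun x a b => by rw [key x a b]; omega),
      HC_of_shift (-2) (fun x a b => by rw [key x a b]; omega)⟩

lemma HS_in {f : ℕ → ℤ} {p q x : ℕ} (h : p < x) (h' : x ≤ q) : HS f p q x = f x - 2 := by
  unfold HS; rw [if_pos ⟨h, h'⟩]
lemma HS_le {f : ℕ → ℤ} {p q x : ℕ} (h : x ≤ p) : HS f p q x = f x := by
  unfold HS; rw [if_neg (by omega)]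
lemma HS_gt {f : ℕ → ℤ} {p q x : ℕ} (h : q < x) : HS f p q x = f x := by
  unfold HS; rw [if_neg (by omega)]

lemma HC_gone {f : ℕ → ℤ} (hf : StepOK f) {p q : ℕ} (h : HC f p q) (j : ℕ) :
    ¬ HC (HS f p q) p j := by
  intro ⟨h1, h2, h3⟩
  have := h3 (p + 1) (by omega) (by omega)
  rw [HS_in (x := p + 1) (by omega) (by have := h.1; omega), HS_le le_rfl] at this
  have := hf p
  omega

lemma HC_last {f : ℕ → ℤ} (hf : StepOK f) {p q : ℕ} (h : HC f p q) : f q = f p + 1 := by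
  have := h.2.2 q h.1 le_rfl
  have := hf q
  have := h.2.1
  omega

lemma HC_new {f : ℕ → ℤ} (hf : StepOK f) {p q i j : ℕ} (h : HC f p q)
    (h' : HC (HS f p q) i j) (hn : ¬ HC f i j) : j = p ∨ i = q := by
  by_contra hc
  push Not at hc
  by_cases c1 : j < p
  · exact hn ((HC_local (Or.inl c1)).1 h')
  by_cases c2 : q < i
  · exact hn ((HC_local (Or.inr (Or.inl c2))).1 h')
  by_cases c3 : p < i ∧ j < q
  · exact hn ((HC_local (Or.inr (Or.inr c3))).1 h')
  have hq := HC_last hf h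
  have hne : i ≠ p := by
    rintro rfl; exact HC_gone hf h _ h'
  obtain ⟨g1, g2, g3⟩ := h'
  obtain ⟨h1, h2, h3⟩ := h
  by_cases c4 : p < i
  · have := g3 q (by omega) (by omega)
    rw [HS_in (by omega) (by omega), HS_in (by omega) (by omega)] at this
    have := h3 i c4 (by omega)
    omega
  · rw [HS_le (x := i) (by omega)] at g2 g3
    by_cases c5 : j < q
    · rw [HS_in (by omega) (by omega)] at g2
      have a := g3 (p + 1) (by omega) (by omega)
      rw [HS_in (by omega) (by omega)] at a
      have := h3 (j + 1) (by omega) (by omega)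
      have := hf p
      omega
    · rw [HS_gt (by omega)] at g2
      refine hn ⟨g1, g2, fun x hx hx' => ?_⟩
      have a := g3 x hx hx'
      unfold HS at a
      split_ifs at a <;> omega

theorem core_fwd (F : ℕ → ℕ → ℤ) (hF : ∀ t, StepOK (F t)) (α β : ℕ → ℕ) (k : ℕ)
    (hs : ∀ t, t < k → HC (F t) (α t) (β t) ∧ F (t + 1) = HS (F t) (α t) (β t))
    (no2 : ∀ t, t + 1 < k → HC (F t) (α (t + 1)) (β (t + 1)) →
      ((α t < α (t + 1) ∧ β (t + 1) < β t) ∨ β t < α (t + 1)) → False)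
    (no3 : ∀ s t, s + 2 ≤ t → t < k →
      (∀ u, s < u → u < t → ¬ HC (F (u - 1)) (α u) (β u)) →
      (∀ u, s ≤ u → u ≤ t → HC (F u) (α t) (β t)) →
      (α s < α t ∧ β t < β s) → (∀ u, s < u → u < t → β t < α u) → False) :
    ∀ d s t, t = s + d → 0 < d → t < k → (∀ u, s ≤ u → u ≤ t → HC (F u) (α t) (β t)) →
      β t < α s ∨ (α t < α s ∧ β s < β t) := by
  intro d
  induction d using Nat.strong_induction_on with
  | _ d IH =>
  intro s t htd hd htk hall
  by_contra hcon
  have IH' : ∀ s' t', s' < t' → t' - s' < d → t' < k →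
      (∀ u, s' ≤ u → u ≤ t' → HC (F u) (α t') (β t')) →
      β t' < α s' ∨ (α t' < α s' ∧ β s' < β t') := fun s' t' h1 h2 h3 h4 =>
    IH (t' - s') h2 s' t' (by omega) (by omega) h3 h4
  have hsk : s < k := by omega
  have hne : α s ≠ α t := by
    intro he
    have := hall (s + 1) (by omega) (by omega)
    rw [(hs s hsk).2, ← he] at this
    exact HC_gone (hF s) (hs s hsk).1 _ this
  have hpos : (α s < α t ∧ β t < β s) ∨ β s < α t := by
    have := HC_nested (hs s hsk).1 (hall s le_rfl (by omega))
    omega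
  have hlt : ∀ u, u < k → α u < β u := fun u hu => (hs u hu).1.1
  have hltt := hlt t htk
  have hlts := hlt s hsk
  -- step 1
  have st1 : ∀ u, s < u → u < t → β t < α u := by
    intro u
    induction u using Nat.strong_induction_on with
    | _ u ihu =>
    intro hsu hut
    rcases IH' u t hut (by omega) htk (fun w h1 h2 => hall w (by omega) h2) with h | h
    · exact h
    exfalso
    have hu := hlt u (by omega)
    have down : ∀ c, c ≤ u - s → HC (F (u - c)) (α u) (β u) := by
      intro c
      induction c with
      | zero => intro _; exact (hs u (by omega)).1
      | succ c ihc =>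
        intro hc
        have h1 := ihc (by omega)
        have e : u - c = (u - (c + 1)) + 1 := by omega
        rw [e, (hs _ (by omega)).2] at h1
        refine (HC_local ?_).1 h1
        by_cases hw : u - (c + 1) = s
        · rw [hw]; omega
        · have := ihu (u - (c + 1)) (by omega) (by omega) (by omega)
          omega
    have := IH' s u hsu (by omega) (by omega) (fun w h1 h2 => by
      have := down (u - w) (by omega)
      rwa [show u - (u - w) = w by omega] at this)
    omega
  -- step 2
  have hd2 : 2 ≤ d := by
    by_contra hc
    have : t = s + 1 := by omega
    subst this
    exact no2 s htk (hall s le_rfl (by omega)) hpos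
  have henc : α s < α t ∧ β t < β s := by
    rcases hpos with h | h
    · exact h
    exfalso
    have h1 := st1 (s + 1) (by omega) (by omega)
    have h2 := (hs (s + 1) (by omega)).1
    rw [(hs s hsk).2] at h2
    exact no2 s (by omega) ((HC_local (by omega)).1 h2) (Or.inr (by omega))
  -- step 3
  have inv : ∀ u, s ≤ u → u < t → (s < u → α u = β (u - 1)) ∧
      (∀ x, α s < x → x ≤ β u → F (u + 1) (β u) ≤ F (u + 1) x) := by
    intro u
    induction u using Nat.strong_induction_on with
    | _ u ihu =>
    intro hsu hut
    have hu := hs u (by omega)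
    have hlast := HC_last (hF u) hu.1
    rcases eq_or_lt_of_le hsu with he | hsu'
    · subst he
      refine ⟨fun h => absurd h (lt_irrefl _), fun x hx hx' => ?_⟩
      rw [hu.2, HS_in hlts le_rfl, HS_in hx hx']
      have := hu.1.2.2 x hx hx'
      omega
    have hau := st1 u hsu' hut
    have hultu := hlt u (by omega)
    have first : α u = β (u - 1) := by
      have hex : ∃ w, s ≤ w ∧ w ≤ u ∧ ¬ HC (F w) (α u) (β u) := by
        by_contra hc
        push Not at hc
        have := IH' s u hsu' (by omega) (by omega) hc
        omega
      obtain ⟨e, he1, he2, he3, he4⟩ : ∃ e, s ≤ e ∧ e < u ∧ ¬ HC (F e) (α u) (β u) ∧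
          ∀ w, e < w → w ≤ u → HC (F w) (α u) (β u) := by
        obtain ⟨w, hw1, hw2, hw3⟩ := hex
        have hmem : ∃ c, c ≤ u - s ∧ ¬ HC (F (u - c)) (α u) (β u) :=
          ⟨u - w, by omega, by rwa [show u - (u - w) = w by omega]⟩
        classical
        have hsp := Nat.find_spec hmem
        have hmin := fun c => Nat.find_min (m := c) hmem
        set c := Nat.find hmem
        have hc0 : c ≠ 0 := by
          intro h0
          rw [h0] at hsp
          exact hsp.2 hu.1
        refine ⟨u - c, by omega, by omega, hsp.2, fun w h1 h2 => ?_⟩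
        by_contra hcc
        exact hmin (u - w) (by omega) ⟨by omega, by rwa [show u - (u - w) = w by omega]⟩
      have hE := hs e (by omega)
      have hcirc := he4 (e + 1) (by omega) (by omega)
      have hcirc' := hcirc
      rw [hE.2] at hcirc'
      rcases HC_new (hF e) hE.1 hcirc' he3 with h | h
      · exfalso
        rcases eq_or_lt_of_le he1 with hes | hes
        · subst hes; omega
        · have i1 := (ihu e he2 he1 (by omega)).1 hes
          have i2 := (ihu (e - 1) (by omega) (by omega) (by omega)).2 (α u) (by omega) (by omega)
          rw [show e - 1 + 1 = e by omega, ← i1] at i2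
          have := hcirc'.2.2 (β u) (by omega) le_rfl
          rw [HS_le (by omega), HS_le (by omega), h] at this
          omega
      · by_cases hee : e = u - 1
        · rw [← hee]; exact h
        exfalso
        have i1 := (ihu (e + 1) (by omega) (by omega) (by omega)).1 (by omega)
        rw [show e + 1 - 1 = e by omega] at i1
        have := he4 (e + 1 + 1) (by omega) (by omega)
        rw [(hs (e + 1) (by omega)).2, h, ← i1] at this
        exact HC_gone (hF _) (hs (e + 1) (by omega)).1 _ this
    refine ⟨fun _ => first, fun x hx hx' => ?_⟩
    rw [hu.2, HS_in hultu le_rfl]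
    by_cases hxx : x ≤ α u
    · rw [HS_le hxx]
      have i2 := (ihu (u - 1) (by omega) (by omega) (by omega)).2 x hx (by omega)
      rw [show u - 1 + 1 = u by omega, ← first] at i2
      omega
    · rw [HS_in (by omega) hx']
      have := hu.1.2.2 x (by omega) hx'
      omega
  refine no3 s t (by omega) htk (fun u h1 h2 hc => ?_) hall henc st1
  have i1 := (inv u (by omega) h2).1 h1
  have hp := (hs (u - 1) (by omega)).1
  have := HC_last (hF _) hp
  have h3 := hc.2.2 (α u + 1) (by omega) (by have := hc.1; omega)
  have := hp.2.1
  rw [i1] at h3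
  omega

end Kh

namespace Kh

variable {N : ℕ}

/-- height function of a weight -/
noncomputable def H (l : Wt N) (x : ℕ) : ℤ :=
  ∑ t : Fin N, if t.val < x then (if l t = true then 1 else -1) else 0

lemma H_succ (l : Wt N) (t : Fin N) :
    H l (t.val + 1) = H l t.val + (if l t = true then 1 else -1) := by
  unfold H
  have : ∀ s : Fin N, (if s.val < t.val + 1 then (if l s = true then (1:ℤ) else -1) else 0)
      = (if s.val < t.val then (if l s = true then 1 else -1) else 0)
        + (if s = t then (if l t = true then 1 else -1) else 0) := by
    intro s
    by_cases hs : s = t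
    · subst hs; simp
    · have : s.val ≠ t.val := fun h => hs (Fin.ext h)
      by_cases h2 : s.val < t.val
      · rw [if_pos (by omega), if_pos h2, if_neg hs, add_zero]
      · rw [if_neg (by omega), if_neg h2, if_neg hs, add_zero]
  rw [Finset.sum_congr rfl (fun s _ => this s), Finset.sum_add_distrib]
  simp

lemma H_step (l : Wt N) : StepOK (H l) := by
  intro x
  by_cases hx : x < N
  · have := H_succ l ⟨x, hx⟩
    simp only at this
    rw [this]
    split_ifs <;> constructor <;> omega
  · have : H l (x + 1) = H l x := by
      unfold H
      refine Finset.sum_congr rfl (fun s _ => ?_)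
      have := s.isLt
      rw [if_pos (show s.val < x + 1 by omega), if_pos (show s.val < x by omega)]
    rw [this]; constructor <;> omega

lemma cnt_eq (l : Wt N) (b : Bool) (i j : Fin N) :
    (cnt l b i j : ℤ) = ∑ t : Fin N, if i < t ∧ t ≤ j ∧ l t = b then 1 else 0 := by
  unfold cnt
  rw [Set.ncard_eq_toFinset_card']
  simp [Finset.sum_boole]

lemma cnt_H (l : Wt N) (i j : Fin N) (hij : i ≤ j) :
    (cnt l true i j : ℤ) - cnt l false i j = H l (j.val + 1) - H l (i.val + 1) := by
  rw [cnt_eq, cnt_eq]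
  unfold H
  rw [← Finset.sum_sub_distrib, ← Finset.sum_sub_distrib]
  refine Finset.sum_congr rfl (fun t _ => ?_)
  have hij' : i.val ≤ j.val := hij
  simp only [Fin.lt_def, Fin.le_def]
  rcases Bool.eq_false_or_eq_true (l t) with hl | hl <;> simp only [hl] <;>
    by_cases h1 : i.val < t.val <;> by_cases h2 : t.val ≤ j.val <;>
    simp [h1, h2, Nat.lt_succ_iff] <;> omega

lemma circle_HC (l : Wt N) (i j : Fin N) : IsCircle l i j ↔ HC (H l) i.val j.val := by
  have hi := H_succ l i
  have hj := H_succ l j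
  constructor
  · rintro ⟨h1, h2, h3, h4, h5⟩
    have h1' : i.val < j.val := h1
    rw [if_pos h2] at hi
    rw [if_neg (by simp [h3])] at hj
    have hc := cnt_H l i j h1.le
    refine ⟨h1, by omega, fun x hx hx' => ?_⟩
    by_cases hxi : x = i.val + 1
    · subst hxi; omega
    · have hk := h5 ⟨x - 1, by omega⟩ (by rw [Fin.lt_def]; simp only; omega)
        (by rw [Fin.lt_def]; simp only; omega)
      have hc := cnt_H l i ⟨x - 1, by omega⟩ (by rw [Fin.le_def]; simp only; omega)
      simp only [show x - 1 + 1 = x by omega] at hc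
      omega
  · rintro ⟨h1, h2, h3⟩
    have e1 := h3 (i.val + 1) (by omega) (by omega)
    have e2 := h3 j.val h1 le_rfl
    have hti : l i = true := by
      by_contra hc
      rw [if_neg hc] at hi
      omega
    have htj : l j = false := by
      by_contra hc
      rw [if_pos (by simpa using hc)] at hj
      omega
    rw [if_pos hti] at hi
    have hc := cnt_H l i j (le_of_lt h1)
    refine ⟨h1, hti, htj, by omega, fun k hk hk' => ?_⟩
    have hk1 : i.val < k.val := hk
    have hk2 : k.val < j.val := hk'
    have := cnt_H l i k hk.le
    have := h3 (k.val + 1) (by omega) (by omega)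
    omega

lemma H_swap (l : Wt N) (i j : Fin N) (h : IsCircle l i j) :
    H (swapC l i j) = HS (H l) i.val j.val := by
  obtain ⟨h1, h2, h3, -⟩ := h
  have h1' : i.val < j.val := h1
  funext x
  have key : H (swapC l i j) x = H l x + ∑ t : Fin N,
      ((if t = i then (if i.val < x then (-2:ℤ) else 0) else 0)
        + (if t = j then (if j.val < x then (2:ℤ) else 0) else 0)) := by
    unfold H
    rw [← Finset.sum_add_distrib]
    refine Finset.sum_congr rfl (fun t _ => ?_)
    unfold swapC
    by_cases hti : t = i
    · subst hti
      have : t ≠ j := fun hh => by rw [hh] at h1'; omega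
      simp only [if_pos, if_neg this, h2, h3]
      split_ifs <;> simp_all
    · by_cases htj : t = j
      · subst htj
        simp only [if_pos, if_neg hti, h2, h3]
        split_ifs <;> simp_all
      · simp [hti, htj]
  rw [key, Finset.sum_add_distrib, Finset.sum_ite_eq' , Finset.sum_ite_eq']
  simp only [Finset.mem_univ, if_true]
  unfold HS
  by_cases a1 : i.val < x <;> by_cases a2 : j.val < x
  · rw [if_pos a1, if_pos a2, if_neg (by omega)]; omega
  · rw [if_pos a1, if_neg a2, if_pos (by omega)]; omega
  · omega
  · rw [if_neg a1, if_neg a2, if_neg (by omega)]; omega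

lemma no_both {x y : Wt N} (h : GammaStep x y) (h' : GammaStep y x) : False := by
  have mono : ∀ {x y : Wt N}, GammaStep x y → (∀ t, H y t ≤ H x t) ∧ ∃ t, H y t < H x t := by
    rintro x y ⟨i, j, hc, rfl⟩
    rw [H_swap x i j hc]
    refine ⟨fun t => ?_, j.val, ?_⟩
    · unfold HS; split_ifs <;> omega
    · rw [HS_in hc.1 le_rfl]; omega
  obtain ⟨t, ht⟩ := (mono h).2
  have := (mono h').1 t
  omega

lemma swap_inj {l : Wt N} {i j i' j' : Fin N} (h : IsCircle l i j) (h' : IsCircle l i' j')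
    (he : swapC l i j = swapC l i' j') : i = i' ∧ j = j' := by
  have hij : i ≠ j := ne_of_lt h.1
  constructor
  · have e := congrFun he i
    unfold swapC at e
    by_contra hc
    rw [if_pos rfl, if_neg hc, h.2.2.1, h'.2.1, h.2.1] at e
    split_ifs at e
  · have e := congrFun he j
    unfold swapC at e
    by_contra hc
    rw [if_neg hij.symm, if_pos rfl, if_neg hc, h'.2.2.1, h.2.2.1, h.2.1] at e
    split_ifs at e

lemma sub_infix (v : ℕ → Wt N) (k s m : ℕ) (h : s + m ≤ k) :
    List.ofFn (fun t : Fin (m + 1) => v (s + t.val)) <:+: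
      List.ofFn (fun t : Fin (k + 1) => v t.val) := by
  rw [List.infix_iff_getElem?]
  refine ⟨s, by simp; omega, fun i hi => ?_⟩
  simp only [List.length_ofFn] at hi
  rw [List.getElem?_eq_getElem (by simp; omega)]
  simp only [List.getElem_ofFn, Nat.add_comm]

lemma infix_get (v : ℕ → Wt N) (k : ℕ) (l : List (Wt N))
    (h : l <:+: List.ofFn (fun t : Fin (k + 1) => v t.val)) :
    ∃ s, l.length + s ≤ k + 1 ∧ ∀ i (hi : i < l.length), l[i] = v (s + i) := by
  rw [List.infix_iff_getElem?] at h
  obtain ⟨s, h1, h2⟩ := h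
  simp only [List.length_ofFn] at h1
  refine ⟨s, h1, fun i hi => ?_⟩
  have := h2 i hi
  rw [List.getElem?_eq_getElem (by simp; omega)] at this
  simp only [List.getElem_ofFn, Option.some.injEq] at this
  rw [← this, Nat.add_comm]

/-- The heart of the equivalence, with 0-based circles. -/
theorem irr_iff (k : ℕ) (v : ℕ → Wt N) (A B : ℕ → Fin N)
    (hs : ∀ t, t < k → IsCircle (v t) (A t) (B t) ∧ v (t + 1) = swapC (v t) (A t) (B t)) :
    Irreducible (List.ofFn (fun t : Fin (k + 1) => v t.val)) ↔
      ∀ s t, s < t → t < k → (∀ u, s ≤ u → u ≤ t → IsCircle (v u) (A t) (B t)) →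
        LeftOf (A t) (B t) (A s) (B s) ∨ Encloses (A t) (B t) (A s) (B s) := by
  constructor
  · intro hirr s t hst htk hall
    have := core_fwd (fun u => H (v u)) (fun u => H_step _) (fun u => (A u).val)
      (fun u => (B u).val) k
      (fun u hu => ⟨(circle_HC _ _ _).1 (hs u hu).1, by
        show H (v (u + 1)) = _
        rw [(hs u hu).2, H_swap _ _ _ (hs u hu).1]⟩)
      ?_ ?_ (t - s) s t (by omega) (by omega) htk
      (fun u h1 h2 => (circle_HC _ _ _).1 (hall u h1 h2))
    · exact this
    · intro u hu hc hpos
      rw [← circle_HC] at hc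
      refine hirr _ (sub_infix v k u 2 (by omega)) (Or.inr (Or.inl ?_))
      have e1 := hs u (by omega)
      have e2 := hs (u + 1) (by omega)
      refine ⟨v u, A u, B u, A (u + 1), B (u + 1), e1.1, hc, hpos, ?_, ?_⟩
      · rw [← e1.2]; exact e2.1
      · rw [← e1.2, ← e2.2]; simp [List.ofFn_succ]
    · intro s t hst htk g1 g2 g3 g4
      refine hirr _ (sub_infix v k s (t - s + 1) (by omega))
        (Or.inr (Or.inr (Or.inr (Or.inl ?_))))
      have et : s + (t - s + 1) - 1 = t := by omega
      refine ⟨t - s + 1, fun i => v (s + i), fun i => A (s + i - 1), fun i => B (s + i - 1),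
        by omega, rfl, ?_, ?_, ?_, ?_, ?_⟩
      · intro i h1 h2
        have := hs (s + i - 1) (by omega)
        rw [show s + i - 1 + 1 = s + i by omega] at this
        simp only
        rw [show s + (i - 1) = s + i - 1 by omega]
        exact this
      · intro i h1 h2 hc
        refine g1 (s + i - 1) (by omega) (by omega) ((circle_HC _ _ _).1 ?_)
        rw [show s + i - 1 - 1 = s + (i - 2) by omega]
        exact hc
      · intro j h1 h2
        simp only [et]
        exact (circle_HC _ _ _).2 (g2 (s + (j - 1)) (by omega) (by omega))
      · simp only [et]
        exact g3
      · intro i h1 h2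
        simp only [et]
        exact g4 (s + i - 1) (by omega) (by omega)
  · intro hcond l hl hin
    obtain ⟨s, hlen, hget⟩ := infix_get v k l hl
    have gs : ∀ u, u < k → GammaStep (v u) (v (u + 1)) := fun u hu =>
      ⟨_, _, (hs u hu).1, (hs u hu).2⟩
    have rev : ∀ x y, 2 ≤ l.length → l.reverse[0]? = some x → l.reverse[1]? = some y →
        GammaStep x y → False := by
      intro x y h2 hx hy hxy
      rw [List.getElem?_reverse (by omega), List.getElem?_eq_getElem (by omega), hget] at hx hy
      simp only [Option.some.injEq] at hx hy
      rw [← hx, ← hy] at hxy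
      have := gs (s + (l.length - 1 - 1)) (by omega)
      rw [show s + (l.length - 1 - 1) + 1 = s + (l.length - 1 - 0) by omega] at this
      exact no_both this hxy
    rcases hin with h | h | h | h | h
    · obtain ⟨x, y, z, rfl, -, h2⟩ := h
      have e1 := hget 1 (by simp)
      have e2 := hget 2 (by simp)
      simp only [List.length_cons, List.length_nil] at hlen
      simp at e1 e2
      rw [e1, e2] at h2
      exact no_both (gs (s + 1) (by omega)) h2
    · obtain ⟨la, i, j, i', j', c1, c2, hpos, c3, rfl⟩ := h
      have e0 := hget 0 (by simp)
      have e1 := hget 1 (by simp)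
      have e2 := hget 2 (by simp)
      simp only [List.length_cons, List.length_nil] at hlen
      simp at e0 e1 e2
      subst e0
      have s0 := hs s (by omega)
      have s1 := hs (s + 1) (by omega)
      obtain ⟨rfl, rfl⟩ := swap_inj c1 s0.1 (by rw [e1, s0.2])
      rw [e1] at c3 e2
      obtain ⟨rfl, rfl⟩ := swap_inj c3 s1.1 (by rw [e2, ← s1.2])
      have := hcond s (s + 1) (by omega) (by omega) (fun u h1 h2 => by
        rcases (by omega : u = s ∨ u = s + 1) with rfl | rfl
        · exact c2
        · exact c3)
      have := c1.1
      have := c2.1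
      unfold LeftOf Encloses at *
      simp only [Fin.lt_def] at *
      omega
    · obtain ⟨la, i, j, i', j', c1, c2, hpos, c3, he⟩ := h
      have hl3 : l.length = 3 := by rw [← List.length_reverse, he]; rfl
      exact rev _ _ (by omega) (by rw [he]; rfl) (by rw [he]; rfl) ⟨i, j, c1, rfl⟩
    · obtain ⟨k', v', a', b', hk', rfl, c1, c2, c3, c4, c5⟩ := h
      simp only [List.length_ofFn] at hlen hget
      have hv : ∀ i, i ≤ k' → v' i = v (s + i) := by
        intro i hi
        have := hget i (by omega)
        rwa [List.getElem_ofFn] at this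
      have hab : ∀ i, 1 ≤ i → i ≤ k' → a' i = A (s + (i - 1)) ∧ b' i = B (s + (i - 1)) := by
        intro i h1 h2
        have e := c1 i h1 h2
        rw [hv _ (by omega), hv _ (by omega)] at e
        have e' := hs (s + (i - 1)) (by omega)
        refine swap_inj e.1 e'.1 ?_
        rw [← e.2, ← e'.2]
        congr 1
        omega
      have ek := hab k' (by omega) le_rfl
      have e1 := hab 1 le_rfl (by omega)
      have := hcond s (s + (k' - 1)) (by omega) (by omega) (fun u h1 h2 => by
        have := c3 (u - s + 1) (by omega) (by omega)
        rw [hv _ (by omega), ek.1, ek.2, show s + (u - s + 1 - 1) = u by omega] at this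
        exact this)
      rw [ek.1, ek.2, e1.1, e1.2] at c4
      have l1 := (hs s (by omega)).1.1
      have l2 := (hs (s + (k' - 1)) (by omega)).1.1
      simp only [Nat.sub_self, Nat.add_zero] at c4
      unfold LeftOf Encloses at *
      simp only [Fin.lt_def] at *
      omega
    · obtain ⟨k', v', a', b', hk', he, c1, -⟩ := h
      have hl3 : l.length = k' + 1 := by rw [← List.length_reverse, he]; simp
      have e := c1 1 le_rfl (by omega)
      refine rev (v' 0) (v' 1) (by omega) ?_ ?_ ⟨_, _, e.1, e.2⟩
      · rw [he, List.getElem?_eq_getElem (by simp)]; simp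
      · rw [he, List.getElem?_eq_getElem (by simp; omega)]; simp

end Kh

namespace Kh

/-- Characterization of irreducible ascending paths
`ȳ_{λ_1}^{λ_2} ⋯ ȳ_{λ_k}^{λ_{k+1}}` (written 0-based: `λ_t = v (t-1)`,
`C_i = (a i, b i)`).  Here `h i` is the largest `h ≤ i-1` such that `C_i` is a circle
of `λ_{i-j}` for all `0 ≤ j ≤ h`. -/
theorem statement9 (m n : ℕ) (hm : 1 ≤ m) (hn : 1 ≤ n) {N : ℕ} (hN : N = m + n)
    (k : ℕ) (hk : 2 ≤ k) (v : ℕ → Wt N) (a b : ℕ → Fin N)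
    (hw : IsWeight m n (v 0))
    (hstep : ∀ i, 1 ≤ i → i ≤ k →
      IsCircle (v (i - 1)) (a i) (b i) ∧ v i = swapC (v (i - 1)) (a i) (b i))
    (h : ℕ → ℕ)
    (hhle : ∀ i, 1 ≤ i → i ≤ k → h i ≤ i - 1)
    (hhall : ∀ i, 1 ≤ i → i ≤ k → ∀ j, j ≤ h i → IsCircle (v (i - 1 - j)) (a i) (b i))
    (hhmax : ∀ i, 1 ≤ i → i ≤ k → ∀ h', h' ≤ i - 1 →
      (∀ j, j ≤ h' → IsCircle (v (i - 1 - j)) (a i) (b i)) → h' ≤ h i) :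
    (Irreducible (List.ofFn (fun t : Fin (k + 1) => v t.val)) ↔
      ∀ i, 1 ≤ i → i ≤ k → h i ≠ 0 → ∀ j, 0 < j → j ≤ h i →
        LeftOf (a i) (b i) (a (i - j)) (b (i - j)) ∨
          Encloses (a i) (b i) (a (i - j)) (b (i - j))) ∧
    ((∀ i, 1 ≤ i → i ≤ k → h i = 0) →
      Irreducible (List.ofFn (fun t : Fin (k + 1) => v t.val))) := by
  have key := irr_iff k v (fun t => a (t + 1)) (fun t => b (t + 1))
    (fun t ht => hstep (t + 1) (by omega) (by omega))
  have main : Irreducible (List.ofFn (fun t : Fin (k + 1) => v t.val)) ↔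
      ∀ i, 1 ≤ i → i ≤ k → h i ≠ 0 → ∀ j, 0 < j → j ≤ h i →
        LeftOf (a i) (b i) (a (i - j)) (b (i - j)) ∨
          Encloses (a i) (b i) (a (i - j)) (b (i - j)) := by
    rw [key]
    constructor
    · intro hc i h1 h2 _ j hj hj'
      have hle := hhle i h1 h2
      have := hc (i - j - 1) (i - 1) (by omega) (by omega) (fun u hu hu' => by
        have := hhall i h1 h2 (i - 1 - u) (by omega)
        rw [show i - 1 - (i - 1 - u) = u by omega] at this
        simp only [show i - 1 + 1 = i by omega]
        exact this)
      simp only [show i - 1 + 1 = i by omega, show i - j - 1 + 1 = i - j by omega] at this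
      exact this
    · intro hc s t hst htk hall
      have hge := hhmax (t + 1) (by omega) (by omega) (t - s) (by omega)
        (fun j hj => hall _ (by omega) (by omega))
      have := hc (t + 1) (by omega) (by omega) (by omega) (t - s) (by omega) hge
      rw [show t + 1 - (t - s) = s + 1 by omega] at this
      exact this
  exact ⟨main, fun h0 => main.2 (fun i h1 h2 h3 => absurd (h0 i h1 h2) h3)⟩

end Kh
end
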